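/- A finitely generated group is strongly amenable if and only if it is virtually nilpotent (i.e., it has a nilpotent subgroup of finite index). -/

import Mathlib

/-- A continuous action of `G` on a topological space `X` is proximal if for all `x, y ∈ X`
the closure of `{(g • x, g • y) : g ∈ G}` in `X × X` meets the diagonal. -/
def IsProximalAction (G X : Type*) [Group G] [MulAction G X] [TopologicalSpace X] : Prop :=
  ∀ x y : X, ∃ z : X, (z, z) ∈ closure {p : X × X | ∃ g : G, p = (g • x, g • y)}

/-- A group `G` is strongly amenable if every proximal continuous action of `G` on a
nonempty compact Hausdorff space has a fixed point. -/
def IsStronglyAmenable (G : Type*) [Group G] : Prop :=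
  ∀ (X : Type) [TopologicalSpace X] [CompactSpace X] [T2Space X] [Nonempty X]
    [MulAction G X] [ContinuousConstSMul G X],
    IsProximalAction G X → ∃ z : X, ∀ g : G, g • z = z

/-- A group is ICC if it is nontrivial and every non-identity element has an infinite
conjugacy class. -/
def IsICC (G : Type*) [Group G] : Prop :=
  Nontrivial G ∧ ∀ g : G, g ≠ 1 → {h : G | IsConj g h}.Infinite

theorem IsProximalAction.of_finiteIndex {G X : Type*} [Group G] [MulAction G X]
    [TopologicalSpace X] [ContinuousConstSMul G X] (hp : IsProximalAction G X)
    (H : Subgroup G) [H.FiniteIndex] : IsProximalAction H X := by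
  intro x y
  obtain ⟨z, hz⟩ := hp x y
  have hcover : {p : X × X | ∃ g : G, p = (g • x, g • y)} ⊆
      ⋃ q : G ⧸ H, {p : X × X | ∃ h : H, p = (q.out • h • x, q.out • h • y)} := by
    rintro _ ⟨g, rfl⟩
    obtain ⟨h, hh⟩ := QuotientGroup.mk_out_eq_mul H g
    refine Set.mem_iUnion.2 ⟨(g : G ⧸ H), h⁻¹, ?_⟩
    simp only [Subgroup.smul_def, smul_smul, hh]
    simp
  have hz' := closure_mono hcover hz
  rw [closure_iUnion_of_finite] at hz'
  obtain ⟨q, hq⟩ := Set.mem_iUnion.1 hz'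
  refine ⟨q.out⁻¹ • z, ?_⟩
  have hc : Continuous fun p : X × X => (q.out⁻¹ • p.1, q.out⁻¹ • p.2) := by fun_prop
  refine map_mem_closure (f := fun p : X × X => (q.out⁻¹ • p.1, q.out⁻¹ • p.2)) hc hq ?_
  rintro _ ⟨h, rfl⟩
  exact ⟨h, by simp⟩

theorem IsProximalAction.exists_fixed_of_commutes {G X : Type*} [Group G] [MulAction G X]
    [TopologicalSpace X] [ContinuousConstSMul G X] [T2Space X] (hp : IsProximalAction G X)
    {Y : Set X} (hY : IsClosed Y) (hne : Y.Nonempty) (hinv : ∀ (g : G), ∀ x ∈ Y, g • x ∈ Y)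
    {a : G} (ha : ∀ (g : G), ∀ x ∈ Y, a • g • x = g • a • x) : ∃ x ∈ Y, a • x = x := by
  obtain ⟨x, hx⟩ := hne
  obtain ⟨z, hz⟩ := hp x (a • x)
  have hcl : IsClosed {p : X × X | p.1 ∈ Y ∧ p.2 = a • p.1} :=
    (hY.preimage continuous_fst).inter
      (isClosed_eq continuous_snd (continuous_fst.const_smul a))
  have hsub : {p : X × X | ∃ g : G, p = (g • x, g • a • x)} ⊆
      {p : X × X | p.1 ∈ Y ∧ p.2 = a • p.1} := by
    rintro _ ⟨g, rfl⟩
    exact ⟨hinv g x hx, (ha g x hx).symm⟩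
  have := closure_minimal hsub hcl hz
  exact ⟨z, this.1, this.2.symm⟩

theorem exists_minimal_closed_invariant (G X : Type*) [Group G] [MulAction G X]
    [TopologicalSpace X] [CompactSpace X] [Nonempty X] :
    ∃ Y : Set X, Minimal
      (fun Y : Set X => IsClosed Y ∧ Y.Nonempty ∧ ∀ (g : G), ∀ x ∈ Y, g • x ∈ Y) Y := by
  refine zorn_superset {Y : Set X | IsClosed Y ∧ Y.Nonempty ∧ ∀ (g : G), ∀ x ∈ Y, g • x ∈ Y} ?_
  intro c hc hchain
  rcases c.eq_empty_or_nonempty with rfl | hne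
  · exact ⟨Set.univ, ⟨isClosed_univ, Set.univ_nonempty, by simp⟩, by simp⟩
  · refine ⟨⋂₀ c, ⟨isClosed_sInter fun s hs => (hc hs).1, ?_, ?_⟩,
      fun s hs => Set.sInter_subset_of_mem hs⟩
    · have := hne.to_subtype
      exact IsCompact.nonempty_sInter_of_directed_nonempty_isCompact_isClosed
        (fun a ha b hb => (hchain.total ha hb).elim
          (fun h => ⟨a, ha, subset_rfl, h⟩) (fun h => ⟨b, hb, h, subset_rfl⟩))
        (fun s hs => (hc hs).2.1)
        (fun s hs => (hc hs).1.isCompact) (fun s hs => (hc hs).1)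
    · intro g x hx s hs
      exact (hc hs).2.2 g x (hx s hs)

theorem IsProximalAction.exists_fixed_of_isNilpotent {G X : Type*} [Group G] [Group.IsNilpotent G]
    [MulAction G X] [TopologicalSpace X] [CompactSpace X] [T2Space X] [Nonempty X]
    [ContinuousConstSMul G X] (hp : IsProximalAction G X) : ∃ z : X, ∀ g : G, g • z = z := by
  obtain ⟨Y, ⟨hcl, hne, hinv⟩, hmin⟩ := exists_minimal_closed_invariant G X
  have key : ∀ n, ∀ a ∈ Subgroup.upperCentralSeries G n, ∀ x ∈ Y, a • x = x := by
    intro n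
    induction n with
    | zero =>
      intro a ha x _
      rw [Subgroup.upperCentralSeries_zero, Subgroup.mem_bot] at ha
      simp [ha]
    | succ n ih =>
      intro a ha
      rw [Subgroup.mem_upperCentralSeries_succ_iff] at ha
      have hcomm : ∀ (g : G), ∀ x ∈ Y, a • g • x = g • a • x := by
        intro g x hx
        have h := ih _ (ha g) _ (hinv g _ (hinv a x hx))
        rw [← h]
        simp [commutatorElement_def, smul_smul, mul_assoc]
      obtain ⟨x, hx, hax⟩ := hp.exists_fixed_of_commutes hcl hne hinv hcomm
      have hsub := hmin (y := {y | y ∈ Y ∧ a • y = y})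
        ⟨hcl.inter (isClosed_eq (continuous_const_smul a) continuous_id), ⟨x, hx, hax⟩, by
          rintro g y ⟨hy, hay⟩
          exact ⟨hinv g y hy, by rw [hcomm g y hy, hay]⟩⟩ (fun y hy => hy.1)
      exact fun y hy => (hsub hy).2
  obtain ⟨n, hn⟩ := Group.IsNilpotent.nilpotent (G := G)
  obtain ⟨x, hx⟩ := hne
  exact ⟨x, fun g => key n g (hn ▸ Subgroup.mem_top g) x hx⟩

theorem IsProximalAction.eq_of_fixed {G X : Type*} [Group G] [MulAction G X]
    [TopologicalSpace X] [T2Space X] (hp : IsProximalAction G X) {x y : X}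
    (hx : ∀ g : G, g • x = x) (hy : ∀ g : G, g • y = y) : x = y := by
  obtain ⟨z, hz⟩ := hp x y
  have hset : {p : X × X | ∃ g : G, p = (g • x, g • y)} ⊆ {(x, y)} := by
    rintro _ ⟨g, rfl⟩
    simp [hx g, hy g]
  have := closure_minimal hset isClosed_singleton hz
  simp only [Set.mem_singleton_iff, Prod.mk.injEq] at this
  rw [← this.1, ← this.2]

theorem isStronglyAmenable_of_virtually_nilpotent {G : Type*} [Group G] (H : Subgroup G)
    [H.FiniteIndex] [hH : Group.IsNilpotent H] : IsStronglyAmenable G := by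
  intro X _ _ _ _ _ _ hp
  have hN : Group.IsNilpotent H.normalCore := by
    exact Group.nilpotent_of_mulEquiv (Subgroup.subgroupOfEquivOfLe (Subgroup.normalCore_le H))
  have : ContinuousConstSMul H.normalCore X := ⟨fun h => continuous_const_smul (h : G)⟩
  have hpN := hp.of_finiteIndex H.normalCore
  obtain ⟨z, hz⟩ := hpN.exists_fixed_of_isNilpotent
  refine ⟨z, fun g => hpN.eq_of_fixed (fun h => ?_) hz⟩
  have h' := hz ⟨g⁻¹ * h * g, by
    simpa using H.normalCore_normal.conj_mem h h.2 g⁻¹⟩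
  rw [Subgroup.smul_def] at h' ⊢
  calc (h : G) • g • z = g • (g⁻¹ * h * g) • z := by simp [smul_smul, mul_assoc]
    _ = g • z := by rw [h']

/-- A subgroup `N` is virtually conilpotent if it contains some term of the lower central series
of a normal subgroup of finite index. For normal `N` this says that `G ⧸ N` is virtually
nilpotent. -/
def IsVirtuallyConilpotent {G : Type*} [Group G] (N : Subgroup G) : Prop :=
  ∃ H : Subgroup G, H.Normal ∧ H.FiniteIndex ∧ ∃ n, H.lowerCentralSeries n ≤ N

theorem Subgroup.exists_finite_lowerCentralSeries_le {G : Type*} [Group G] (H : Subgroup G)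
    [H.Normal] (hH : H.FG) (n : ℕ) : ∃ A : Set G, A.Finite ∧ A ⊆ H.lowerCentralSeries n ∧
      ∀ K : Subgroup G, K.Normal → A ⊆ K → H.lowerCentralSeries n ≤ K := by
  obtain ⟨S, rfl⟩ := hH
  induction n with
  | zero =>
    refine ⟨S, S.finite_toSet, Subgroup.subset_closure, fun K _ hK => ?_⟩
    simpa [Subgroup.lowerCentralSeries_zero] using hK
  | succ n ih =>
    obtain ⟨A, hA, hAn, hAK⟩ := ih
    refine ⟨Set.image2 (fun a s => a * s * a⁻¹ * s⁻¹) A S, hA.image2 _ S.finite_toSet, ?_, ?_⟩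
    · rintro _ ⟨a, ha, s, hs, rfl⟩
      rw [Subgroup.lowerCentralSeries_succ]
      exact Subgroup.commutator_mem_commutator (hAn ha) (Subgroup.subset_closure hs)
    · intro K hK hsub
      have hmap : ((Subgroup.closure (S : Set G)).map (QuotientGroup.mk' K)).Normal :=
        Subgroup.Normal.map ‹_› _ (QuotientGroup.mk'_surjective K)
      have hle := hAK ((Subgroup.centralizer
        ((Subgroup.closure (S : Set G)).map (QuotientGroup.mk' K) : Set (G ⧸ K))).comap
          (QuotientGroup.mk' K)) inferInstance (by
        intro a ha
        rw [MonoidHom.map_closure, Subgroup.coe_comap, Set.mem_preimage, SetLike.mem_coe,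
          Subgroup.centralizer_closure,
          Subgroup.mem_centralizer_iff, Set.forall_mem_image]
        intro s hs
        rw [← map_mul, ← map_mul]
        refine (QuotientGroup.eq (s := K)).2 ?_
        have h1 := hK.conj_mem _ (hsub ⟨a, ha, s, hs, rfl⟩) (s * a)⁻¹
        convert h1 using 1
        group)
      rw [Subgroup.lowerCentralSeries_succ, Subgroup.commutator_le]
      intro g hg h hh
      have := hle hg
      rw [Subgroup.mem_comap, Subgroup.mem_centralizer_iff] at this
      have := this _ (Subgroup.mem_map_of_mem _ hh)
      rw [← QuotientGroup.ker_mk' K, MonoidHom.mem_ker, map_commutatorElement,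
        commutatorElement_eq_one_iff_mul_comm, this]

theorem IsVirtuallyConilpotent.exists_mem_chain {G : Type*} [Group G] (hG : Group.FG G)
    {c : Set (Subgroup G)} (hc : IsChain (· ≤ ·) c) (hne : c.Nonempty)
    (hn : ∀ N ∈ c, N.Normal) (h : IsVirtuallyConilpotent (sSup c)) :
    ∃ N ∈ c, IsVirtuallyConilpotent N := by
  obtain ⟨H, hH, hfin, n, hle⟩ := h
  have hHfg : H.FG := by
    have := Subgroup.fg_of_index_ne_zero H
    rwa [← Group.fg_iff_subgroup_fg]
  obtain ⟨A, hA, hAn, hAK⟩ := H.exists_finite_lowerCentralSeries_le hHfg n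
  have key : ∀ B : Set G, B.Finite → B ⊆ (sSup c : Subgroup G) → ∃ N ∈ c, B ⊆ N := by
    intro B hB
    induction B, hB using Set.Finite.induction_on with
    | empty => exact fun _ => ⟨_, hne.some_mem, Set.empty_subset _⟩
    | insert _ _ ih =>
      intro hsub
      obtain ⟨ha, hs⟩ := Set.insert_subset_iff.1 hsub
      obtain ⟨N, hN, hsN⟩ := ih hs
      obtain ⟨M, hM, haM⟩ := (Subgroup.mem_sSup_of_directedOn hne hc.directedOn).1 ha
      rcases hc.total hN hM with h | h
      · exact ⟨M, hM, Set.insert_subset haM (hsN.trans h)⟩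
      · exact ⟨N, hN, Set.insert_subset (h haM) hsN⟩
  obtain ⟨N, hN, hAN⟩ := key A hA (hAn.trans hle)
  exact ⟨N, hN, H, hH, hfin, n, hAK N (hn N hN) hAN⟩

theorem index_centralizer_singleton {G : Type*} [Group G] (g : G) :
    (Subgroup.centralizer {g}).index = {h : G | IsConj g h}.ncard := by
  have heq : MulAction.orbit (ConjAct G) g = {h : G | IsConj g h} := by
    ext x
    rw [ConjAct.mem_orbit_conjAct]
    exact ⟨fun hx => hx.symm, fun hx => hx.symm⟩
  have hidx := MulAction.index_stabilizer (ConjAct G) g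
  rw [heq, ConjAct.stabilizer_eq_centralizer] at hidx
  exact hidx

theorem finiteIndex_centralizer_normalClosure {G : Type*} [Group G] {g : G}
    (hg : {h : G | IsConj g h}.Finite) :
    (Subgroup.centralizer (Subgroup.normalClosure {g} : Set G)).FiniteIndex := by
  have hset : Group.conjugatesOfSet {g} = {h : G | IsConj g h} := by
    simp [Group.conjugatesOfSet, conjugatesOf]
  rw [Subgroup.normalClosure, Subgroup.centralizer_closure, hset,
    Subgroup.centralizer_eq_iInf]
  have := hg.to_subtype
  rw [iInf_subtype']
  refine Subgroup.finiteIndex_iInf fun ⟨h, hh⟩ => ⟨?_⟩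
  rw [index_centralizer_singleton]
  have hconj : {x : G | IsConj h x} = {x : G | IsConj g x} :=
    Set.ext fun x => ⟨fun hx => IsConj.trans hh hx, fun hx => (IsConj.symm hh).trans hx⟩
  rw [hconj]
  exact ((Set.ncard_pos hg).2 ⟨g, IsConj.refl g⟩).ne'

theorem exists_normal_isICC_quotient {G : Type*} [Group G] (hG : Group.FG G)
    (h : ¬ IsVirtuallyConilpotent (⊥ : Subgroup G)) :
    ∃ N : Subgroup G, ∃ _ : N.Normal, IsICC (G ⧸ N) := by
  obtain ⟨N, -, hN⟩ := zorn_le_nonempty₀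
    {N : Subgroup G | N.Normal ∧ ¬ IsVirtuallyConilpotent N} (by
      intro c hc hchain N hN
      refine ⟨sSup c, ⟨?_, fun hs => ?_⟩, fun K hK => le_sSup hK⟩
      · constructor
        intro x hx g
        obtain ⟨K, hK, hxK⟩ := (Subgroup.mem_sSup_of_directedOn ⟨N, hN⟩ hchain.directedOn).1 hx
        exact le_sSup hK ((hc hK).1.conj_mem x hxK g)
      · obtain ⟨K, hK, hgood⟩ := hs.exists_mem_chain hG hchain ⟨N, hN⟩ fun K hK => (hc hK).1
        exact (hc hK).2 hgood) ⊥ ⟨inferInstance, h⟩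
  have hnormal := hN.prop.1
  refine ⟨N, hnormal, ?_, ?_⟩
  · rw [QuotientGroup.nontrivial_iff]
    rintro rfl
    exact hN.prop.2 ⟨⊤, inferInstance, inferInstance, 0, le_top⟩
  · intro q hq hfin
    have hfin : {h : G ⧸ N | IsConj q h}.Finite := hfin
    have hCf := finiteIndex_centralizer_normalClosure hfin
    set Q := Subgroup.normalClosure {q}
    have hgood : IsVirtuallyConilpotent (Q.comap (QuotientGroup.mk' N)) := by
      by_contra hbad
      have hle := hN.le_of_ge ⟨inferInstance, hbad⟩ (by
        exact (QuotientGroup.ker_mk' N).ge.trans (Subgroup.ker_le_comap _ _))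
      obtain ⟨g, rfl⟩ := QuotientGroup.mk'_surjective N q
      have hg : g ∈ N := hle (Subgroup.mem_comap.2
        (Subgroup.subset_normalClosure (Set.mem_singleton _)))
      exact hq ((QuotientGroup.eq_one_iff g).2 hg)
    obtain ⟨H, hH, hHf, n, hHn⟩ := hgood
    set C := (Subgroup.centralizer (Q : Set (G ⧸ N))).comap (QuotientGroup.mk' N)
    have hC : C.FiniteIndex := ⟨by
      rw [Subgroup.index_comap_of_surjective _ (QuotientGroup.mk'_surjective N)]
      exact hCf.index_ne_zero⟩
    refine hN.prop.2 ⟨H ⊓ C, inferInstance, inferInstance, n + 1, ?_⟩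
    have hmono : ∀ k, (H ⊓ C).lowerCentralSeries k ≤ H.lowerCentralSeries k := by
      intro k
      induction k with
      | zero => simp [Subgroup.lowerCentralSeries_zero]
      | succ k ih =>
        rw [Subgroup.lowerCentralSeries_succ, Subgroup.lowerCentralSeries_succ]
        exact Subgroup.commutator_mono ih inf_le_left
    rw [Subgroup.lowerCentralSeries_succ, Subgroup.commutator_le]
    intro x hx y hy
    have hxQ := hHn (hmono n hx)
    have hyC := (Subgroup.mem_inf.1 hy).2
    rw [Subgroup.mem_comap] at hxQ hyC
    rw [Subgroup.mem_centralizer_iff] at hyC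
    rw [← QuotientGroup.ker_mk' N, MonoidHom.mem_ker, map_commutatorElement,
      commutatorElement_eq_one_iff_mul_comm]
    exact hyC _ hxQ

theorem exists_finiteIndex_isNilpotent_of_isVirtuallyConilpotent {G : Type*} [Group G]
    (h : IsVirtuallyConilpotent (⊥ : Subgroup G)) :
    ∃ H : Subgroup G, H.FiniteIndex ∧ Group.IsNilpotent H := by
  obtain ⟨H, -, hf, n, hn⟩ := h
  exact ⟨H, hf, (Subgroup.isNilpotent_iff_lowerCentralSeries H).2 ⟨n, le_bot_iff.1 hn⟩⟩

section Nets

open Pointwise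

variable {G : Type*} [Group G]

/-- `D` is a maximal subset of `U` no two points of which differ by an element of `Z`. -/
structure IsNet (Z U D : Set G) : Prop where
  subset : D ⊆ U
  eq_of_mem : ∀ d ∈ D, ∀ e ∈ D, d⁻¹ * e ∈ Z → d = e
  exists_mul_mem : ∀ g ∈ U, ∃ z ∈ Z, g * z ∈ D

theorem exists_isNet_superset {Z U D : Set G} (h1 : 1 ∈ Z) (hinv : ∀ z ∈ Z, z⁻¹ ∈ Z)
    (hDU : D ⊆ U) (hD : ∀ d ∈ D, ∀ e ∈ D, d⁻¹ * e ∈ Z → d = e) :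
    ∃ E, D ⊆ E ∧ IsNet Z U E := by
  obtain ⟨E, hDE, hE⟩ := zorn_subset_nonempty
    {E : Set G | E ⊆ U ∧ ∀ d ∈ E, ∀ e ∈ E, d⁻¹ * e ∈ Z → d = e} (by
      intro c hc hchain _
      refine ⟨⋃₀ c, ⟨Set.sUnion_subset fun s hs => (hc hs).1, ?_⟩,
        fun s hs => Set.subset_sUnion_of_mem hs⟩
      rintro d ⟨s, hs, hds⟩ e ⟨t, ht, het⟩ h
      rcases hchain.total hs ht with hst | hst
      · exact (hc ht).2 d (hst hds) e het h
      · exact (hc hs).2 d hds e (hst het) h) D ⟨hDU, hD⟩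
  refine ⟨E, hDE, hE.prop.1, hE.prop.2, fun g hg => ?_⟩
  by_contra! hno
  have hgE : g ∈ E := by
    refine hE.le_of_ge (y := insert g E) ⟨Set.insert_subset hg hE.prop.1, ?_⟩
      (Set.subset_insert _ _) (Set.mem_insert _ _)
    rintro d (rfl | hd) e (rfl | he) h
    · rfl
    · exact absurd (by simpa using he) (hno _ h)
    · refine absurd ?_ (hno _ (hinv _ h))
      simpa using hd
    · exact hE.prop.2 d hd e he h
  exact hno 1 h1 (by simpa using hgE)

theorem IsNet.exists_glue {Z U L Q : Set G} {D V : G → Set G} (h1 : 1 ∈ Z)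
    (hinv : ∀ z ∈ Z, z⁻¹ ∈ Z) (hD : ∀ q ∈ Q, IsNet Z (V q) (D q))
    (hU : ∀ q ∈ Q, ∀ l ∈ L, (q * l ∈ U ↔ q * l ∈ V q))
    (hQ : ∀ q ∈ Q, ∀ r ∈ Q, q⁻¹ * r ∈ L * Z * L⁻¹ → D q = D r) :
    ∃ E, IsNet Z U E ∧ ∀ q ∈ Q, ∀ l, (∀ z ∈ Z, l * z ∈ L) → (q * l ∈ E ↔ q * l ∈ D q) := by
  obtain ⟨E, hDE, hE⟩ := exists_isNet_superset (Z := Z) (U := U)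
    (D := {g | ∃ q ∈ Q, ∃ l ∈ L, g = q * l ∧ g ∈ D q}) h1 hinv
    (by
      rintro _ ⟨q, hq, l, hl, rfl, hg⟩
      exact (hU q hq l hl).2 ((hD q hq).subset hg))
    (by
      rintro _ ⟨q, hq, l, hl, rfl, hg⟩ _ ⟨r, hr, m, hm, rfl, hg'⟩ h
      have : D q = D r := hQ q hq r hr
        ⟨_, ⟨l, hl, _, h, rfl⟩, m⁻¹, Set.inv_mem_inv.2 hm, by simp [mul_assoc]⟩
      exact (hD q hq).eq_of_mem _ hg _ (this ▸ hg') h)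
  refine ⟨E, hE, fun q hq l hl => ?_⟩
  have hlL : l ∈ L := by simpa using hl 1 h1
  constructor
  · intro hql
    obtain ⟨z, hz, hzD⟩ := (hD q hq).exists_mul_mem _ ((hU q hq l hlL).1 (hE.subset hql))
    have hzE : q * l * z ∈ E := hDE ⟨q, hq, l * z, hl z hz, mul_assoc _ _ _, hzD⟩
    rw [hE.eq_of_mem _ hql _ hzE (by simpa [mul_assoc] using hz)]
    exact hzD
  · intro hql
    exact hDE ⟨q, hq, l, hlL, rfl, hql⟩

theorem IsNet.smul {Z U D : Set G} (h : IsNet Z U D) (g : G) : IsNet Z (g • U) (g • D) where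
  subset := Set.smul_set_mono h.subset
  eq_of_mem := by
    rintro _ ⟨d, hd, rfl⟩ _ ⟨e, he, rfl⟩ hde
    simp only [smul_eq_mul] at hde ⊢
    rw [h.eq_of_mem d hd e he (by simpa [mul_assoc] using hde)]
  exists_mul_mem := by
    rintro _ ⟨u, hu, rfl⟩
    obtain ⟨z, hz, hzD⟩ := h.exists_mul_mem u hu
    exact ⟨z, hz, u * z, hzD, by simp [mul_assoc]⟩

theorem IsNet.eventually {ι : Type*} {Z : Set G} (hZ : Z.Finite) {U D : ι → Set G}
    {u : Ultrafilter ι} (h : ∀ᶠ i in u, IsNet Z (U i) (D i)) :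
    IsNet Z {g | ∀ᶠ i in u, g ∈ U i} {g | ∀ᶠ i in u, g ∈ D i} where
  subset := fun g hg => by
    filter_upwards [h, hg] with i hi hgi using hi.subset hgi
  eq_of_mem := fun d hd e he hde => by
    obtain ⟨i, hi, h1, h2⟩ := (h.and (Filter.Eventually.and hd he)).exists
    exact hi.eq_of_mem d h1 e h2 hde
  exists_mul_mem := fun g hg => by
    have : ∀ᶠ i in u, ∃ z ∈ Z, g * z ∈ D i := by
      filter_upwards [h, hg] with i hi hgi using hi.exists_mul_mem g hgi
    exact (Ultrafilter.eventually_exists_mem_iff hZ).1 this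

theorem eventually_mem_compl_mul {ι : Type*} {V : Set G} (hV : V.Finite) {D : ι → Set G}
    (u : Ultrafilter ι) :
    {g | ∀ᶠ i in u, g ∈ (D i * V)ᶜ} = ({g | ∀ᶠ i in u, g ∈ D i} * V)ᶜ := by
  ext g
  have h : ∀ A : Set G, g ∈ A * V ↔ ∃ v ∈ V, g * v⁻¹ ∈ A := by
    intro A
    constructor
    · rintro ⟨a, ha, v, hv, rfl⟩
      exact ⟨v, hv, by simpa using ha⟩
    · rintro ⟨v, hv, ha⟩
      exact ⟨_, ha, v, hv, by simp⟩
  simp only [Set.mem_ofPred_eq, Set.mem_compl_iff, Ultrafilter.eventually_not, h,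
    Ultrafilter.eventually_exists_mem_iff hV]

end Nets

section ICC

open Pointwise

variable {G : Type*} [Group G]

theorem IsICC.infinite (hG : IsICC G) : Infinite G := by
  obtain ⟨⟨a, b, hab⟩, h⟩ := hG
  by_contra hfin
  rw [not_infinite_iff_finite] at hfin
  exact h (a * b⁻¹) (by rwa [Ne, mul_inv_eq_one]) (Set.toFinite _)

theorem IsICC.exists_conj_notMem (hG : IsICC G) {A W R : Set G} (hA : A.Finite) (hW : W.Finite)
    (hR : R.Finite) : ∃ s ∉ A, ∀ w ∈ W, w ≠ 1 → s * w * s⁻¹ ∉ R := by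
  classical
  have := hG.infinite
  by_contra! hno
  obtain ⟨σ, hσ⟩ : ∃ σ : G → G → G, ∀ w r, (∃ s, s * w * s⁻¹ = r) → σ w r * w * (σ w r)⁻¹ = r := by
    choose! σ hσ using fun (w r : G) (h : ∃ s, s * w * s⁻¹ = r) => h
    exact ⟨σ, hσ⟩
  obtain ⟨k, hk, hkf⟩ := Subgroup.exists_finiteIndex_of_leftCoset_cover
    (s := hA.toFinset.disjSum ((hW.toFinset.erase 1) ×ˢ hR.toFinset))
    (H := Sum.elim (fun _ => (⊥ : Subgroup G)) (fun p => Subgroup.centralizer {p.1}))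
    (g := Sum.elim (fun a => a) (fun p => σ p.1 p.2)) (by
      refine Set.eq_univ_of_forall fun s => ?_
      by_cases hs : s ∈ A
      · exact Set.mem_iUnion₂.2 ⟨Sum.inl s, by simpa using hs, 1, by simp, by simp⟩
      · obtain ⟨w, hw, hw1, hr⟩ := hno s hs
        refine Set.mem_iUnion₂.2 ⟨Sum.inr (w, s * w * s⁻¹), by simp [hw, hw1, hr], ?_⟩
        have h := hσ w (s * w * s⁻¹) ⟨s, rfl⟩
        refine ⟨(σ w (s * w * s⁻¹))⁻¹ * s, ?_, by simp⟩
        set t := σ w (s * w * s⁻¹)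
        simp only [Sum.elim_inr, SetLike.mem_coe, Subgroup.mem_centralizer_singleton_iff]
        calc t⁻¹ * s * w = t⁻¹ * (s * w * s⁻¹) * s := by group
          _ = t⁻¹ * (t * w * t⁻¹) * s := by rw [h]
          _ = w * (t⁻¹ * s) := by group)
  rcases k with a | ⟨w, r⟩
  · have h0 := hkf.index_ne_zero
    simp only [Sum.elim_inl, Subgroup.index_bot] at h0
    exact h0 Nat.card_eq_zero_of_infinite
  · have hw : w ≠ 1 := by
      have := (Finset.mem_product.1 (Finset.inr_mem_disjSum.1 hk)).1
      exact (Finset.mem_erase.1 this).1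
    refine hG.2 w hw (Set.finite_of_ncard_ne_zero ?_)
    rw [← index_centralizer_singleton]
    exact hkf.index_ne_zero

theorem IsICC.exists_rigid_finite (hG : IsICC G) {W R : Set G} (hW : W.Finite) (hR : R.Finite) :
    ∃ T : Set G, T.Finite ∧ T.Nonempty ∧ (∀ t ∈ T, ∀ t' ∈ T, t⁻¹ * t' ∈ R → t = t') ∧
      ∀ u, (∀ t ∈ T, u * t ∈ T * W) → u = 1 := by
  have := hG.infinite
  obtain ⟨a, ha⟩ := (((hW.inv.mul hW).union (hR.union hR.inv))).exists_notMem
  simp only [Set.mem_union, not_or, Set.mem_inv] at ha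
  obtain ⟨haW, haR, haR'⟩ := ha
  set P : Set G := {1, a} with hPdef
  have hP : P.Finite := by simp [P]
  have h1P : (1 : G) ∈ P := by simp [P]
  have haP : a ∈ P := by simp [P]
  have hPW := hP.mul hW
  obtain ⟨s, hs, hsW⟩ := hG.exists_conj_notMem (W := W)
    (A := (W⁻¹ * W ∪ (P * W)⁻¹ * (P * W) ∪ a • ((P * W)⁻¹ * (P * W))) ∪
      ((R ∪ R⁻¹) ∪ (a • R ∪ a • R⁻¹))) (R := P * W)
    (((hW.inv.mul hW).union (hPW.inv.mul hPW)).union ((hPW.inv.mul hPW).smul_set)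
      |>.union ((hR.union hR.inv).union (hR.smul_set.union hR.inv.smul_set))) hW hPW
  simp only [Set.mem_union, not_or, Set.mem_smul_set_iff_inv_smul_mem, smul_eq_mul,
    Set.mem_inv, mul_inv_rev, inv_inv] at hs
  obtain ⟨⟨⟨hs1, hs2⟩, hs3⟩, ⟨hs4, hs5⟩, hs6, hs7⟩ := hs
  have hmem : ∀ {x y : G}, x ∈ P * W → y ∈ P * W → x⁻¹ * y ∈ (P * W)⁻¹ * (P * W) :=
    fun hx hy => ⟨_, Set.inv_mem_inv.2 hx, _, hy, rfl⟩
  have hmemW : ∀ {x y : G}, x ∈ W → y ∈ W → x⁻¹ * y ∈ W⁻¹ * W :=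
    fun hx hy => ⟨_, Set.inv_mem_inv.2 hx, _, hy, rfl⟩
  simp only [← mul_inv_rev] at hs2 hs3
  refine ⟨insert s P, hP.insert s, Set.insert_nonempty _ _, ?_, fun u hu => ?_⟩
  · rintro t (rfl | rfl | rfl) t' (rfl | rfl | rfl) h <;> first | rfl | simp_all
  · by_contra hu1
    have hsplit : ∀ x, x ∈ insert s P * W → x ∈ P * W ∨ ∃ w ∈ W, x = s * w := by
      rintro _ ⟨j, rfl | hj, w, hw, rfl⟩
      · exact Or.inr ⟨w, hw, rfl⟩
      · exact Or.inl ⟨j, hj, w, hw, rfl⟩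
    have hu0 : u ∈ insert s P * W := by simpa using hu 1 (Or.inr h1P)
    have hua := hu a (Or.inr haP)
    have hus := hu s (Or.inl rfl)
    rcases hsplit _ hus with h2 | ⟨w2, hw2, h2⟩
    · rcases hsplit _ hu0 with h0 | ⟨w0, hw0, h0⟩
      · exact hs2 (by simpa using hmem h0 h2)
      · rcases hsplit _ hua with h3 | ⟨w1, hw1, h3⟩
        · refine hs3 ?_
          have := hmem h3 h2
          simpa [mul_assoc] using this
        · refine haW ?_
          have : a = w0⁻¹ * w1 := by
            rw [eq_inv_mul_iff_mul_eq]
            apply mul_left_cancel (a := s)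
            rw [← h3, ← mul_assoc, h0]
          rw [this]
          exact hmemW hw0 hw1
    · have hconj : s * w2 * s⁻¹ = u := by rw [← h2]; simp
      have hw21 : w2 ≠ 1 := by
        rintro rfl
        exact hu1 (by simpa using hconj.symm)
      rcases hsplit _ hu0 with h0 | ⟨w0, hw0, h0⟩
      · exact hsW w2 hw2 hw21 (hconj ▸ h0)
      · refine hs1 ?_
        have : s = w0⁻¹ * w2 := by
          rw [eq_inv_mul_iff_mul_eq]
          apply mul_left_cancel (a := s)
          rw [← h2, ← mul_assoc, h0]
        have h := hmemW hw0 hw2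
        rwa [← this] at h

end ICC

theorem mul_pow_succ_le_of_add_eq {x y k m c v : ℕ} (hsplit : x + y = k) (hle : k ≤ 2 ^ m * x)
    (h : k * (2 ^ m) ^ c ≤ (2 ^ m - 1) ^ c * v) :
    y * (2 ^ m) ^ (c + 1) ≤ (2 ^ m - 1) ^ (c + 1) * v := by
  obtain ⟨M, hM⟩ : ∃ M, 2 ^ m = M + 1 := ⟨2 ^ m - 1, (Nat.sub_add_cancel Nat.one_le_two_pow).symm⟩
  rw [hM] at hle h ⊢
  simp only [Nat.add_sub_cancel] at h ⊢
  have h1 : y * (M + 1) ≤ M * k := by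
    subst hsplit
    nlinarith
  calc y * (M + 1) ^ (c + 1) = (y * (M + 1)) * (M + 1) ^ c := by ring
    _ ≤ (M * k) * (M + 1) ^ c := Nat.mul_le_mul_right _ h1
    _ = M * (k * (M + 1) ^ c) := by ring
    _ ≤ M * (M ^ c * v) := Nat.mul_le_mul_left _ h
    _ = M ^ (c + 1) * v := by ring

theorem Finset.card_filter_forall_inter_ne_mul_le {α ι : Type*} [DecidableEq α] [DecidableEq ι]
    (V : Finset α) (s : Finset ι) (P a : ι → Finset α) (m : ℕ)
    (hdisj : ∀ i ∈ s, ∀ j ∈ s, i ≠ j → Disjoint (P i) (P j)) (hcard : ∀ i ∈ s, (P i).card ≤ m)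
    (ha : ∀ i ∈ s, a i ⊆ P i) (haV : ∀ i ∈ s, a i ⊆ V) :
    (V.powerset.filter fun S => ∀ i ∈ s, S ∩ P i ≠ a i).card * (2 ^ m) ^ s.card ≤
      (2 ^ m - 1) ^ s.card * 2 ^ V.card := by
  induction s using Finset.induction_on with
  | empty => simp
  | insert i s hi ih =>
    have ih := ih (fun j hj k hk => hdisj j (Finset.mem_insert_of_mem hj) k
      (Finset.mem_insert_of_mem hk)) (fun j hj => hcard j (Finset.mem_insert_of_mem hj))
      (fun j hj => ha j (Finset.mem_insert_of_mem hj))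
      (fun j hj => haV j (Finset.mem_insert_of_mem hj))
    have hii := Finset.mem_insert_self i s
    set N := V.powerset.filter fun S => ∀ i ∈ s, S ∩ P i ≠ a i with hN
    have hsplit := Finset.card_filter_add_card_filter_not (s := N) (fun S => S ∩ P i = a i)
    have heq : (V.powerset.filter fun S => ∀ j ∈ insert i s, S ∩ P j ≠ a j) =
        N.filter (fun S => ¬ (S ∩ P i = a i)) := by
      ext S
      simp only [hN, Finset.mem_filter, Finset.forall_mem_insert]
      tauto
    have hle : N.card ≤ 2 ^ m * (N.filter fun S => S ∩ P i = a i).card := by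
      calc N.card ≤ ((P i).powerset ×ˢ (N.filter fun S => S ∩ P i = a i)).card := by
            refine Finset.card_le_card_of_injOn (fun S => (S ∩ P i, (S \ P i) ∪ a i)) ?_ ?_
            · intro S hS
              obtain ⟨hSV, hS⟩ := Finset.mem_filter.1 hS
              rw [Finset.mem_powerset] at hSV
              refine Finset.mem_product.2 ⟨Finset.mem_powerset.2 Finset.inter_subset_right,
                Finset.mem_filter.2 ⟨Finset.mem_filter.2 ⟨Finset.mem_powerset.2
                  (Finset.union_subset (Finset.sdiff_subset.trans hSV) (haV i hii)), ?_⟩, ?_⟩⟩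
              · intro j hj
                have hd := hdisj i hii j (Finset.mem_insert_of_mem hj) (by rintro rfl; exact hi hj)
                have : ((S \ P i) ∪ a i) ∩ P j = S ∩ P j := by
                  ext x
                  have h1 : x ∈ P i → x ∉ P j := fun h => Finset.disjoint_left.1 hd h
                  have h2 := @ha i hii x
                  grind
                rw [this]
                exact hS j hj
              · ext x
                have h2 := @ha i hii x
                grind
            · intro S _ S' _ h
              simp only [Prod.mk.injEq] at h
              ext x
              have h1 := Finset.ext_iff.1 h.1 x
              have h2 := Finset.ext_iff.1 h.2 x
              have h3 := @ha i hii x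
              clear ih hsplit hcard
              grind
        _ = 2 ^ (P i).card * (N.filter fun S => S ∩ P i = a i).card := by
            rw [Finset.card_product, Finset.card_powerset]
        _ ≤ 2 ^ m * (N.filter fun S => S ∩ P i = a i).card := by
            gcongr
            · norm_num
            · exact hcard i hii
    rw [heq, Finset.card_insert_of_notMem hi]
    exact mul_pow_succ_le_of_add_eq hsplit hle ih

theorem exists_sq_mul_mul_pow_lt (m : ℕ) :
    ∃ n, 0 < n ∧ n ^ 2 * m * (2 ^ m - 1) ^ n < (2 ^ m) ^ n := by
  have hr : |(1 - 1 / 2 ^ m : ℝ)| < 1 := by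
    have h1 : (1 : ℝ) ≤ 2 ^ m := one_le_pow₀ (by norm_num)
    have h2 : 0 < (1 : ℝ) / 2 ^ m := by positivity
    have h3 : (1 : ℝ) / 2 ^ m ≤ 1 := by
      rw [div_le_one (by positivity)]
      exact h1
    rw [abs_of_nonneg (by linarith)]
    linarith
  have ht := (tendsto_pow_const_mul_const_pow_of_abs_lt_one 2 hr).const_mul (m : ℝ)
  rw [mul_zero] at ht
  obtain ⟨n, hn, hn0⟩ :=
    ((ht.eventually_lt_const one_pos).and (Filter.eventually_gt_atTop 0)).exists
  refine ⟨n, hn0, ?_⟩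
  have h2 : (0 : ℝ) < (2 ^ m) ^ n := by positivity
  have h3 : (1 - 1 / 2 ^ m : ℝ) = ((2 ^ m - 1 : ℕ) : ℝ) / 2 ^ m := by
    rw [Nat.cast_sub Nat.one_le_two_pow]
    push_cast
    field_simp
  rw [h3, div_pow] at hn
  have h4 : (n : ℝ) ^ 2 * m * ((2 ^ m - 1 : ℕ) : ℝ) ^ n < (2 ^ m) ^ n := by
    rw [← div_lt_one h2]
    convert hn using 1
    ring
  exact_mod_cast h4

section Markers

open Pointwise

variable {G : Type*} [Group G]

theorem exists_card_eq_separated [Infinite G] {X : Set G} (hX : X.Finite)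
    (hinv : ∀ x ∈ X, x⁻¹ ∈ X) (n : ℕ) :
    ∃ B : Finset G, B.card = n ∧ ∀ b ∈ B, ∀ c ∈ B, b⁻¹ * c ∈ X → b = c := by
  classical
  induction n with
  | zero => exact ⟨∅, by simp⟩
  | succ n ih =>
    obtain ⟨B, hB, hsep⟩ := ih
    obtain ⟨g, hg⟩ := ((B.finite_toSet.mul hX).union B.finite_toSet).exists_notMem
    rw [Set.mem_union, not_or] at hg
    have key : ∀ b ∈ B, b⁻¹ * g ∉ X := fun b hb h => hg.1 ⟨b, hb, _, h, by simp⟩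
    refine ⟨insert g B, by rw [Finset.card_insert_of_notMem (by exact_mod_cast hg.2), hB], ?_⟩
    intro b hb c hc h
    rcases Finset.mem_insert.1 hb with rfl | hb' <;> rcases Finset.mem_insert.1 hc with rfl | hc'
    · rfl
    · exact absurd (by simpa using hinv _ h) (key c hc')
    · exact absurd h (key b hb')
    · exact hsep b hb' c hc' h

theorem exists_markers [Infinite G] {X : Set G} (hX : X.Finite) (h1 : 1 ∈ X)
    (hinv : ∀ x ∈ X, x⁻¹ ∈ X) :
    ∃ B μ : Set G, B.Finite ∧ B.Nonempty ∧ μ.Finite ∧ (∀ b ∈ B, ∀ c ∈ B, b⁻¹ * c ∈ X → b = c) ∧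
      (∀ b ∈ μ, ∀ c ∈ μ, b⁻¹ * c ∈ X → b = c) ∧ ∀ y ∈ B * X * B⁻¹, ∃ b ∈ B, y * b ∈ μ := by
  classical
  obtain ⟨X, rfl⟩ := hX.exists_finset_coe
  obtain ⟨n, hn0, hn⟩ := exists_sq_mul_mul_pow_lt X.card
  obtain ⟨B, hB, hsep⟩ := exists_card_eq_separated (G := G) (X := ((X * X : Finset G) : Set G))
    (Finset.finite_toSet _) (by
      intro x hx
      obtain ⟨y, hy, z, hz, rfl⟩ := Finset.mem_mul.1 hx
      exact Finset.mem_mul.2 ⟨_, hinv z hz, _, hinv y hy, by simp⟩) n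
  set Y : Finset G := B * X * B⁻¹ with hY
  have hYcard : Y.card ≤ n ^ 2 * X.card := by
    calc Y.card ≤ (B * X).card * B⁻¹.card := Finset.card_mul_le
      _ ≤ B.card * X.card * B⁻¹.card := Nat.mul_le_mul_right _ Finset.card_mul_le
      _ = n ^ 2 * X.card := by rw [Finset.card_inv, hB]; ring
  set V : Finset G := Y * B with hV
  let bad : G → Finset (Finset G) := fun y =>
    V.powerset.filter fun S => ∀ b ∈ B, S ∩ ((y * b) • X) ≠ {y * b}
  have hbad : ∀ y ∈ Y, (bad y).card * (2 ^ X.card) ^ n ≤ (2 ^ X.card - 1) ^ n * 2 ^ V.card := by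
    intro y hy
    have := Finset.card_filter_forall_inter_ne_mul_le V B (fun b => (y * b) • X)
      (fun b => {y * b}) X.card ?_ ?_ ?_ ?_
    · rwa [hB] at this
    · intro b hb c hc hbc
      rw [Finset.disjoint_left]
      intro g hg hg'
      obtain ⟨x, hx, rfl⟩ := Finset.mem_smul_finset.1 hg
      obtain ⟨x', hx', h⟩ := Finset.mem_smul_finset.1 hg'
      refine hbc (hsep b hb c hc (Finset.mem_mul.2 ⟨x, hx, x'⁻¹, hinv x' hx', ?_⟩))
      simp only [smul_eq_mul, mul_assoc, mul_right_inj] at h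
      rw [eq_inv_mul_iff_mul_eq, ← mul_assoc, ← h]
      simp
    · intro b _
      rw [Finset.card_smul_finset]
    · intro b _
      rw [Finset.singleton_subset_iff]
      exact Finset.mem_smul_finset.2 ⟨1, h1, by simp⟩
    · intro b hb
      rw [Finset.singleton_subset_iff]
      exact Finset.mul_mem_mul hy hb
  obtain ⟨S, hSV, hS⟩ : ∃ S ∈ V.powerset, S ∉ Y.biUnion bad := by
    refine Finset.exists_mem_notMem_of_card_lt_card ?_
    rw [Finset.card_powerset]
    have h2 : 0 < (2 ^ X.card) ^ n := by positivity
    refine lt_of_mul_lt_mul_right ?_ h2.le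
    calc (Y.biUnion bad).card * (2 ^ X.card) ^ n
        ≤ (∑ y ∈ Y, (bad y).card) * (2 ^ X.card) ^ n :=
          Nat.mul_le_mul_right _ Finset.card_biUnion_le
      _ = ∑ y ∈ Y, (bad y).card * (2 ^ X.card) ^ n := Finset.sum_mul _ _ _
      _ ≤ ∑ y ∈ Y, (2 ^ X.card - 1) ^ n * 2 ^ V.card := Finset.sum_le_sum hbad
      _ = Y.card * (2 ^ X.card - 1) ^ n * 2 ^ V.card := by
          rw [Finset.sum_const, smul_eq_mul, mul_assoc]
      _ ≤ n ^ 2 * X.card * (2 ^ X.card - 1) ^ n * 2 ^ V.card :=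
          Nat.mul_le_mul_right _ (Nat.mul_le_mul_right _ hYcard)
      _ < (2 ^ X.card) ^ n * 2 ^ V.card := Nat.mul_lt_mul_of_pos_right hn (by positivity)
      _ = 2 ^ V.card * (2 ^ X.card) ^ n := mul_comm _ _
  refine ⟨B, {u | u ∈ V ∧ S ∩ (u • X) = {u}}, B.finite_toSet, ?_, V.finite_toSet.subset
    (fun u hu => hu.1), ?_, ?_, ?_⟩
  · exact Finset.card_pos.1 (hB ▸ hn0)
  · intro b hb c hc h
    exact hsep b hb c hc (Finset.mem_mul.2 ⟨_, h, 1, h1, mul_one _⟩)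
  · rintro b ⟨-, hb⟩ c ⟨-, hc⟩ h
    have hcS : c ∈ S := (Finset.mem_inter.1 (hc ▸ Finset.mem_singleton_self c)).1
    have : c ∈ S ∩ (b • X) :=
      Finset.mem_inter.2 ⟨hcS, Finset.mem_smul_finset.2 ⟨_, h, by simp⟩⟩
    rw [hb, Finset.mem_singleton] at this
    exact this.symm
  · intro y hy
    have hy : y ∈ Y := by
      rw [hY, ← Finset.mem_coe]
      simpa using hy
    by_contra! hno
    refine hS (Finset.mem_biUnion.2 ⟨y, hy, Finset.mem_filter.2 ⟨hSV, fun b hb h => ?_⟩⟩)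
    exact hno b hb ⟨Finset.mul_mem_mul hy hb, h⟩

end Markers

section Template

open Pointwise

variable {G : Type*} [Group G]

theorem inv_mem_conj_set {A X : Set G} (hinv : ∀ x ∈ X, x⁻¹ ∈ X) :
    ∀ y ∈ A * X * A⁻¹, y⁻¹ ∈ A * X * A⁻¹ := by
  rintro _ ⟨_, ⟨a, ha, x, hx, rfl⟩, c, hc, rfl⟩
  exact ⟨_, ⟨c⁻¹, hc, _, hinv x hx, rfl⟩, a⁻¹, Set.inv_mem_inv.2 ha, by simp [mul_assoc]⟩

theorem mem_conj_set {A X : Set G} {g k a x b : G} (ha : a ∈ A) (hx : x ∈ X) (hb : b ∈ A)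
    (h : g * a * x = k * b) : g⁻¹ * k ∈ A * X * A⁻¹ :=
  ⟨_, ⟨a, ha, x, hx, rfl⟩, b⁻¹, Set.inv_mem_inv.2 hb, by
    simp only
    rw [eq_inv_mul_iff_mul_eq, ← mul_assoc, ← mul_assoc, h, mul_inv_cancel_right]⟩

theorem IsICC.exists_template (hG : IsICC G) {X : Set G} (hX : X.Finite) (h1 : 1 ∈ X)
    (hinv : ∀ x ∈ X, x⁻¹ ∈ X) :
    ∃ Y Z B I V : Set G, (Y.Finite ∧ 1 ∈ Y ∧ ∀ y ∈ Y, y⁻¹ ∈ Y) ∧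
      (Z.Finite ∧ 1 ∈ Z ∧ ∀ z ∈ Z, z⁻¹ ∈ Z) ∧ B.Finite ∧ I.Finite ∧ V.Finite ∧
      (∀ D C : Set G, IsNet Z Set.univ D → IsNet Y (D * V)ᶜ C →
        ∀ m ∈ C * B ∪ D * I, ∀ m' ∈ C * B ∪ D * I, m⁻¹ * m' ∈ X → m = m') ∧
      ∀ D C D' C' : Set G, IsNet Z Set.univ D → IsNet Y (D * V)ᶜ C →
        IsNet Z Set.univ D' → IsNet Y (D' * V)ᶜ C' →
        ((C * B ∪ D * I) ∩ (C' * B ∪ D' * I)).Nonempty := by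
  have := hG.infinite
  obtain ⟨B, μ, hB, ⟨b₀, hb₀⟩, hμ, hBsep, hμsep, hμY⟩ := exists_markers hX h1 hinv
  obtain ⟨T, hT, ⟨t₀, ht₀⟩, hTsep, hTW⟩ := hG.exists_rigid_finite (W := μ * X * B⁻¹)
    (R := μ * X * μ⁻¹) ((hμ.mul hX).mul hB.inv) ((hμ.mul hX).mul hμ.inv)
  have h1Y : (1 : G) ∈ B * X * B⁻¹ := ⟨b₀, ⟨b₀, hb₀, 1, h1, by simp⟩, b₀⁻¹, by simpa, by simp⟩
  obtain ⟨b₁, hb₁, hb₁μ⟩ := hμY 1 h1Y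
  rw [one_mul] at hb₁μ
  set V := T * (μ * X * B⁻¹) with hVdef
  have hVf : V.Finite := hT.mul ((hμ.mul hX).mul hB.inv)
  have hI : (T * μ).Finite := hT.mul hμ
  refine ⟨B * X * B⁻¹, (T * μ) * X * (T * μ)⁻¹ ∪ V * (T⁻¹ * T) * V⁻¹, B, T * μ, V,
    ⟨(hB.mul hX).mul hB.inv, h1Y, inv_mem_conj_set hinv⟩,
    ⟨((hI.mul hX).mul hI.inv).union ((hVf.mul (hT.inv.mul hT)).mul hVf.inv), ?_, ?_⟩,
    hB, hI, hVf, ?_, ?_⟩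
  · exact Or.inl ⟨t₀ * b₁, ⟨t₀ * b₁, ⟨t₀, ht₀, b₁, hb₁μ, rfl⟩, 1, h1, by simp⟩, (t₀ * b₁)⁻¹,
      Set.inv_mem_inv.2 ⟨t₀, ht₀, b₁, hb₁μ, rfl⟩, by simp⟩
  · rintro z (hz | hz)
    · exact Or.inl (inv_mem_conj_set hinv z hz)
    · refine Or.inr (inv_mem_conj_set ?_ z hz)
      rintro _ ⟨t, ht, t', ht', rfl⟩
      exact ⟨t'⁻¹, Set.inv_mem_inv.2 ht', t⁻¹, ht, by simp⟩
  · intro D C hD hC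
    have hCD : ∀ c ∈ C, ∀ b ∈ B, ∀ x ∈ X, ∀ d ∈ D, ∀ t ∈ T, ∀ ν ∈ μ,
        c * b * x = d * (t * ν) → False := by
      intro c hc b hb x hx d hd t ht ν hν h
      refine hC.subset hc ⟨d, hd, t * (ν * x⁻¹ * b⁻¹), ⟨t, ht, _, ⟨_, ⟨ν, hν, x⁻¹, hinv x hx,
        rfl⟩, b⁻¹, Set.inv_mem_inv.2 hb, rfl⟩, rfl⟩, ?_⟩
      calc d * (t * (ν * x⁻¹ * b⁻¹)) = d * (t * ν) * x⁻¹ * b⁻¹ := by group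
        _ = c * b * x * x⁻¹ * b⁻¹ := by rw [h]
        _ = c := by group
    rintro _ (⟨c, hc, b, hb, rfl⟩ | ⟨d, hd, _, ⟨t, ht, ν, hν, rfl⟩, rfl⟩) _
      (⟨c', hc', b', hb', rfl⟩ | ⟨d', hd', _, ⟨t', ht', ν', hν', rfl⟩, rfl⟩) h <;>
      simp only at h ⊢
    · have hcc := hC.eq_of_mem c hc c' hc' (mem_conj_set hb h hb' (by group))
      subst hcc
      rw [hBsep b hb b' hb' (by simpa [mul_assoc] using h)]
    · exact (hCD c hc b hb _ h d' hd' t' ht' ν' hν' (by group)).elim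
    · refine (hCD c' hc' b' hb' _ (hinv _ h) d hd t ht ν hν (by group)).elim
    · have hdd := hD.eq_of_mem d hd d' hd'
        (Or.inl (mem_conj_set ⟨t, ht, ν, hν, rfl⟩ h ⟨t', ht', ν', hν', rfl⟩ (by group)))
      subst hdd
      have htt := hTsep t ht t' ht' (mem_conj_set hν h hν' (by group))
      subst htt
      rw [hμsep ν hν ν' hν' (by simpa [mul_assoc] using h)]
  · intro D C D' C' hD hC hD' hC'
    obtain ⟨z, -, hz⟩ := hD'.exists_mul_mem 1 (Set.mem_univ _)
    set d' := 1 * z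
    by_cases hall : ∀ t ∈ T, d' * t ∈ D * V
    · have hall' : ∀ t ∈ T, ∃ d ∈ D, ∃ v ∈ V, d * v = d' * t := fun t ht => by
        obtain ⟨d, hd, v, hv, h⟩ := hall t ht
        exact ⟨d, hd, v, hv, h⟩
      choose! d hdD v hvV hdv using hall'
      have hdd : ∀ t ∈ T, d t = d t₀ := by
        intro t ht
        refine hD.eq_of_mem _ (hdD t ht) _ (hdD t₀ ht₀) (Or.inr (mem_conj_set (hvV t ht)
          ⟨t⁻¹, Set.inv_mem_inv.2 ht, t₀, ht₀, rfl⟩ (hvV t₀ ht₀) ?_))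
        simp only
        rw [hdv t ht, hdv t₀ ht₀]
        group
      have hu := hTW ((d t₀)⁻¹ * d') (fun t ht => by
        rw [mul_assoc, ← hdv t ht, hdd t ht, inv_mul_cancel_left]
        exact hvV t ht)
      rw [inv_mul_eq_one] at hu
      have hdD' : d' ∈ D := hu ▸ hdD t₀ ht₀
      exact ⟨d' * (t₀ * b₁), Or.inr ⟨d', hdD', _, ⟨t₀, ht₀, b₁, hb₁μ, rfl⟩, rfl⟩,
        Or.inr ⟨d', hz, _, ⟨t₀, ht₀, b₁, hb₁μ, rfl⟩, rfl⟩⟩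
    · push Not at hall
      obtain ⟨t, ht, hdt⟩ := hall
      obtain ⟨y, hy, hyC⟩ := hC.exists_mul_mem _ hdt
      obtain ⟨b, hb, hyb⟩ := hμY y hy
      exact ⟨d' * (t * (y * b)), Or.inl ⟨_, hyC, b, hb, by simp [mul_assoc]⟩,
        Or.inr ⟨d', hz, _, ⟨t, ht, _, hyb, rfl⟩, rfl⟩⟩

end Template

section Shifts

open Pointwise Topology

variable {G : Type*} [Group G]

/-- A set `S` of configurations on `G` is irreducible with respect to `K` if the values at the
points of any set `Q` of members of `S` indexed by `Q` are realized by a single member of `S`,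
provided that the members indexed by points differing by an element of `K` agree. -/
def IsIrreducibleShift (S : Set (G → Bool)) (K : Set G) : Prop :=
  ∀ (Q : Set G) (φ : G → G → Bool), (∀ q ∈ Q, φ q ∈ S) →
    (∀ q ∈ Q, ∀ r ∈ Q, q⁻¹ * r ∈ K → φ q = φ r) → ∃ x ∈ S, ∀ q ∈ Q, x q = φ q q

theorem IsIrreducibleShift.mono {S : Set (G → Bool)} {K K' : Set G} (h : IsIrreducibleShift S K)
    (hK : K ⊆ K') : IsIrreducibleShift S K' :=
  fun Q φ hφ hc => h Q φ hφ fun q hq r hr hqr => hc q hq r hr (hK hqr)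

theorem IsIrreducibleShift.nonempty {S : Set (G → Bool)} {K : Set G}
    (h : IsIrreducibleShift S K) : S.Nonempty := by
  obtain ⟨x, hx, -⟩ := h ∅ (fun _ _ => true) (by simp) (by simp)
  exact ⟨x, hx⟩

/-- A closed shift-invariant set of configurations that is irreducible with respect to some
finite set. -/
structure IsStronglyIrreducibleShift (S : Set (G → Bool)) : Prop where
  isClosed : IsClosed S
  translate_mem : ∀ (g : G), ∀ x ∈ S, (fun h => x (g * h)) ∈ S
  exists_irreducible : ∃ K : Set G, K.Finite ∧ IsIrreducibleShift S K

theorem eventually_apply_eq_of_le_nhds {ι α : Type*} [TopologicalSpace α] [DiscreteTopology α]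
    {x : ι → α} {u : Filter (ι → α)} (hu : u ≤ 𝓝 x) (i : ι) : ∀ᶠ y in u, y i = x i :=
  hu (((continuous_apply i).tendsto x).eventually_mem ((isOpen_discrete {x i}).mem_nhds rfl))

theorem isStronglyIrreducibleShift_isNet {Z : Set G} (hZ : Z.Finite) (h1 : 1 ∈ Z)
    (hinv : ∀ z ∈ Z, z⁻¹ ∈ Z) :
    IsStronglyIrreducibleShift {x : G → Bool | IsNet Z Set.univ {g | x g = true}} where
  isClosed := by
    rw [isClosed_iff_ultrafilter]
    intro x u hu hS
    have h := IsNet.eventually (u := u) hZ hS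
    have hx : {g | ∀ᶠ y : G → Bool in u, g ∈ {g | y g = true}} = {g | x g = true} := by
      ext g
      have hg := eventually_apply_eq_of_le_nhds hu g
      constructor
      · intro hy
        obtain ⟨y, hy1, hy2⟩ := (hg.and hy).exists
        exact hy1.symm.trans hy2
      · intro hxg
        filter_upwards [hg] with y hy using hy.trans hxg
    rw [hx] at h
    simpa using h
  translate_mem := fun g x hx => by
    have h := IsNet.smul hx g⁻¹
    have hset : g⁻¹ • {h | x h = true} = {h | x (g * h) = true} := by
      ext h
      simp [Set.mem_smul_set_iff_inv_smul_mem]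
    rwa [Set.smul_set_univ, hset] at h
  exists_irreducible := by
    classical
    refine ⟨Z * Z * Z⁻¹, (hZ.mul hZ).mul hZ.inv, fun Q φ hφ hc => ?_⟩
    obtain ⟨E, hE, hEQ⟩ := IsNet.exists_glue (U := Set.univ) (L := Z) h1 hinv
      (D := fun q => {g | φ q g = true}) (V := fun _ => Set.univ) hφ (by simp)
      (fun q hq r hr h => by simp only [hc q hq r hr h])
    refine ⟨fun g => decide (g ∈ E), by simpa using hE, fun q hq => ?_⟩
    have := hEQ q hq 1 (by simp)
    rw [mul_one] at this
    simp [this]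

theorem IsStronglyIrreducibleShift.exists_subset_agreeing (hG : IsICC G) {S : Set (G → Bool)}
    (hS : IsStronglyIrreducibleShift S) {F : Set G} (hF : F.Finite) :
    ∃ S' ⊆ S, IsStronglyIrreducibleShift S' ∧
      ∀ x ∈ S', ∀ y ∈ S', ∃ g, ∀ f ∈ F, x (g * f) = y (g * f) := by
  classical
  obtain ⟨K, hK, h1K, hKinv, hSK⟩ : ∃ K : Set G, K.Finite ∧ 1 ∈ K ∧ (∀ k ∈ K, k⁻¹ ∈ K) ∧
      IsIrreducibleShift S K := by
    obtain ⟨K, hK, hSK⟩ := hS.exists_irreducible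
    refine ⟨insert 1 (K ∪ K⁻¹), (hK.union hK.inv).insert 1, Or.inl rfl, ?_,
      hSK.mono fun k hk => Or.inr (Or.inl hk)⟩
    rintro k (rfl | hk | hk)
    · exact Or.inl inv_one
    · exact Or.inr (Or.inr (Set.inv_mem_inv.2 hk))
    · exact Or.inr (Or.inl hk)
  obtain ⟨p, hp⟩ := hSK.nonempty
  obtain ⟨Y, Z, B, I, V, ⟨hY, h1Y, hYinv⟩, ⟨hZ, h1Z, hZinv⟩, hB, hI, hV, hsep, hhit⟩ :=
    hG.exists_template (X := insert 1 (F * K * F⁻¹)) (((hF.mul hK).mul hF.inv).insert 1)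
      (Or.inl rfl) (by
        rintro x (rfl | hx)
        · exact Or.inl inv_one
        · exact Or.inr (inv_mem_conj_set hKinv x hx))
  refine ⟨{x | x ∈ S ∧ ∃ D C : Set G, IsNet Z Set.univ D ∧ IsNet Y (D * V)ᶜ C ∧
    ∀ m ∈ C * B ∪ D * I, ∀ f ∈ F, x (m * f) = p f}, fun x hx => hx.1, ⟨?_, ?_, ?_⟩, ?_⟩
  · rw [isClosed_iff_ultrafilter]
    intro x u hu hS'
    have hS'' := hS'
    choose! D C hD hC hDC using fun (x : G → Bool)
      (hx : x ∈ {x | x ∈ S ∧ ∃ D C : Set G, IsNet Z Set.univ D ∧ IsNet Y (D * V)ᶜ C ∧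
        ∀ m ∈ C * B ∪ D * I, ∀ f ∈ F, x (m * f) = p f}) => hx.2
    refine ⟨isClosed_iff_ultrafilter.1 hS.isClosed x u hu (Filter.mem_of_superset hS'
      fun y hy => hy.1), {g | ∀ᶠ y in u, g ∈ D y}, {g | ∀ᶠ y in u, g ∈ C y}, ?_, ?_, ?_⟩
    · have h := IsNet.eventually (u := u) (U := fun _ => Set.univ) (D := D) hZ
        (Filter.mem_of_superset hS' hD)
      simpa using h
    · rw [← eventually_mem_compl_mul hV]
      exact IsNet.eventually hY (Filter.mem_of_superset hS' hC)
    · rintro _ (⟨c, hc, b, hb, rfl⟩ | ⟨d, hd, i, hi, rfl⟩) f hf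
      · obtain ⟨y, ⟨hyS, hyx⟩, hyc⟩ :=
          ((Filter.Eventually.and hS' (eventually_apply_eq_of_le_nhds hu (c * b * f))).and hc).exists
        exact hyx ▸ hDC y hyS _ (Or.inl ⟨c, hyc, b, hb, rfl⟩) f hf
      · obtain ⟨y, ⟨hyS, hyx⟩, hyd⟩ :=
          ((Filter.Eventually.and hS' (eventually_apply_eq_of_le_nhds hu (d * i * f))).and hd).exists
        exact hyx ▸ hDC y hyS _ (Or.inr ⟨d, hyd, i, hi, rfl⟩) f hf
  · rintro g x ⟨hx, D, C, hD, hC, hDC⟩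
    refine ⟨hS.translate_mem g x hx, g⁻¹ • D, g⁻¹ • C, ?_, ?_, ?_⟩
    · simpa using hD.smul g⁻¹
    · have h := hC.smul g⁻¹
      rwa [Set.smul_set_compl, ← smul_mul_assoc] at h
    · rintro m hm f hf
      rw [smul_mul_assoc, smul_mul_assoc, ← Set.smul_set_union,
        Set.mem_smul_set_iff_inv_smul_mem, inv_inv] at hm
      simpa [mul_assoc] using hDC _ hm f hf
  · set J := K * F⁻¹ with hJ
    set L₂ := J * B⁻¹ * Y with hL₂
    set L₁ := (L₂ * V⁻¹ ∪ J * I⁻¹) * Z with hL₁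
    have hJf : J.Finite := hK.mul hF.inv
    have hL₂f : L₂.Finite := (hJf.mul hB.inv).mul hY
    have hL₁f : L₁.Finite := ((hL₂f.mul hV.inv).union (hJf.mul hI.inv)).mul hZ
    refine ⟨(K ∪ J * J⁻¹) ∪ (L₁ * Z * L₁⁻¹ ∪ L₂ * Y * L₂⁻¹), (hK.union (hJf.mul hJf.inv)).union
      (((hL₁f.mul hZ).mul hL₁f.inv).union ((hL₂f.mul hY).mul hL₂f.inv)), fun Q φ hφ hc => ?_⟩
    choose! D C hD hC hDC using fun (x : G → Bool)
      (hx : x ∈ {x | x ∈ S ∧ ∃ D C : Set G, IsNet Z Set.univ D ∧ IsNet Y (D * V)ᶜ C ∧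
        ∀ m ∈ C * B ∪ D * I, ∀ f ∈ F, x (m * f) = p f}) => hx.2
    obtain ⟨E, hE, hEQ⟩ := IsNet.exists_glue (U := Set.univ) (L := L₁) h1Z hZinv
      (D := fun q => D (φ q)) (V := fun _ => Set.univ) (fun q hq => hD _ (hφ q hq)) (by simp)
      (fun q hq r hr h => by simp only [hc q hq r hr (Or.inr (Or.inl h))])
    obtain ⟨E', hE', hEQ'⟩ := IsNet.exists_glue (U := (E * V)ᶜ) (L := L₂) h1Y hYinv
      (D := fun q => C (φ q)) (V := fun q => (D (φ q) * V)ᶜ) (fun q hq => hC _ (hφ q hq))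
      (by
        intro q hq l hl
        have key : ∀ v ∈ V, (q * (l * v⁻¹) ∈ E ↔ q * (l * v⁻¹) ∈ D (φ q)) := fun v hv =>
          hEQ q hq _ fun z hz =>
            ⟨_, Or.inl ⟨l, hl, v⁻¹, Set.inv_mem_inv.2 hv, rfl⟩, z, hz, rfl⟩
        refine not_congr ⟨?_, ?_⟩ <;> rintro ⟨e, he, v, hv, h⟩ <;>
          refine ⟨e, ?_, v, hv, h⟩ <;>
          have he' : e = q * (l * v⁻¹) := by
            rw [← mul_assoc, ← h]
            simp
        · rw [he'] at he ⊢
          exact (key v hv).1 he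
        · rw [he'] at he ⊢
          exact (key v hv).2 he)
      (fun q hq r hr h => by simp only [hc q hq r hr (Or.inr (Or.inr h))])
    have hagree : ∀ q ∈ Q, ∀ m ∈ E' * B ∪ E * I, q⁻¹ * m ∈ J →
        m ∈ C (φ q) * B ∪ D (φ q) * I := by
      rintro q hq _ (⟨c, hcE, b, hb, rfl⟩ | ⟨d, hdE, i, hi, rfl⟩) hm
      · refine Or.inl ⟨c, ?_, b, hb, rfl⟩
        have := hEQ' q hq (q⁻¹ * (c * b) * b⁻¹) fun y hy =>
          ⟨_, ⟨_, hm, b⁻¹, Set.inv_mem_inv.2 hb, rfl⟩, y, hy, rfl⟩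
        simp only [mul_assoc, mul_inv_cancel, mul_one, mul_inv_cancel_left] at this
        exact this.1 hcE
      · refine Or.inr ⟨d, ?_, i, hi, rfl⟩
        have := hEQ q hq (q⁻¹ * (d * i) * i⁻¹) fun z hz =>
          ⟨_, Or.inr ⟨_, hm, i⁻¹, Set.inv_mem_inv.2 hi, rfl⟩, z, hz, rfl⟩
        simp only [mul_assoc, mul_inv_cancel, mul_one, mul_inv_cancel_left] at this
        exact this.1 hdE
    obtain ⟨ψ, hψS, hψp, hψφ⟩ : ∃ ψ : G → G → Bool, (∀ m, ψ m ∈ S) ∧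
        (∀ m ∈ E' * B ∪ E * I, ∀ f ∈ F, ψ m (m * f) = p f) ∧
        ∀ q ∈ Q, ∀ m, q⁻¹ * m ∈ J → ψ m = φ q := by
      have : ∀ m, ∃ x ∈ S, (m ∈ E' * B ∪ E * I → ∀ f ∈ F, x (m * f) = p f) ∧
          ∀ q ∈ Q, q⁻¹ * m ∈ J → x = φ q := by
        intro m
        by_cases hm : ∃ q ∈ Q, q⁻¹ * m ∈ J
        · obtain ⟨q, hq, hqm⟩ := hm
          refine ⟨φ q, (hφ q hq).1, fun hmE f hf => hDC _ (hφ q hq) m (hagree q hq m hmE hqm) f hf,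
            fun r hr hrm => hc q hq r hr (Or.inl (Or.inr ⟨_, hqm, _, Set.inv_mem_inv.2 hrm, ?_⟩))⟩
          simp [mul_assoc]
        · push Not at hm
          refine ⟨_, hS.translate_mem m⁻¹ p hp, fun _ f _ => ?_, fun q hq hqm =>
            absurd hqm (hm q hq)⟩
          simp
      choose ψ h1 h2 h3 using this
      exact ⟨ψ, h1, h2, fun q hq m hm => h3 m q hq hm⟩
    have hsepE := hsep E E' hE hE'
    have hμ : ∀ a, ∃ m, a ∈ (E' * B ∪ E * I) * F → m ∈ E' * B ∪ E * I ∧ m⁻¹ * a ∈ F := by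
      intro a
      by_cases ha : a ∈ (E' * B ∪ E * I) * F
      · obtain ⟨m, hm, f, hf, rfl⟩ := ha
        exact ⟨m, fun _ => ⟨hm, by simpa using hf⟩⟩
      · exact ⟨1, fun h => absurd h ha⟩
    choose μ hμ using hμ
    have hQF : ∀ q ∈ Q, ∀ a ∈ (E' * B ∪ E * I) * F, q⁻¹ * a ∈ K → ψ (μ a) = φ q := by
      intro q hq a ha hqa
      refine hψφ q hq _ ⟨_, hqa, _, Set.inv_mem_inv.2 (hμ a ha).2, ?_⟩
      simp [mul_assoc]
    have hFF : ∀ a ∈ (E' * B ∪ E * I) * F, ∀ m ∈ E' * B ∪ E * I, ∀ f ∈ F, a⁻¹ * (m * f) ∈ K →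
        μ a = m := by
      intro a ha m hm f hf h
      refine hsepE _ (hμ a ha).1 m hm (Or.inr ⟨_, ⟨_, (hμ a ha).2, _, h, rfl⟩, f⁻¹,
        Set.inv_mem_inv.2 hf, ?_⟩)
      simp [mul_assoc]
    obtain ⟨x, hxS, hx⟩ := hSK (Q ∪ (E' * B ∪ E * I) * F) (fun a => if a ∈ Q then φ a else ψ (μ a))
      (by
        intro a _
        by_cases ha : a ∈ Q
        · simpa [ha] using (hφ a ha).1
        · simpa [ha] using hψS _)
      (by
        intro a ha b hb hab
        have hba : b⁻¹ * a ∈ K := by simpa using hKinv _ hab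
        by_cases haQ : a ∈ Q <;> by_cases hbQ : b ∈ Q <;> simp only [haQ, hbQ, if_true, if_false]
        · exact hc a haQ b hbQ (Or.inl (Or.inl hab))
        · exact (hQF a haQ b (hb.resolve_left hbQ) hab).symm
        · exact hQF b hbQ a (ha.resolve_left haQ) hba
        · have hb' := hμ b (hb.resolve_left hbQ)
          rw [hFF a (ha.resolve_left haQ) _ hb'.1 _ hb'.2 (by simpa using hab)])
    refine ⟨x, ⟨hxS, E, E', hE, hE', fun m hm f hf => ?_⟩, fun q hq => ?_⟩
    · have ha : m * f ∈ (E' * B ∪ E * I) * F := ⟨m, hm, f, hf, rfl⟩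
      have hμm : μ (m * f) = m := hFF _ ha m hm f hf (by simpa using h1K)
      rw [hx _ (Or.inr ha)]
      split_ifs with hmf
      · rw [← hQF _ hmf _ ha (by simpa using h1K), hμm]
        exact hψp m hm f hf
      · rw [hμm]
        exact hψp m hm f hf
    · rw [hx q (Or.inl hq), if_pos hq]
  · rintro x ⟨-, D, C, hD, hC, hDC⟩ y ⟨-, D', C', hD', hC', hDC'⟩
    obtain ⟨g, hg, hg'⟩ := hhit D C D' C' hD hC hD' hC'
    exact ⟨g, fun f hf => (hDC g hg f hf).trans (hDC' g hg' f hf).symm⟩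

end Shifts

theorem IsStronglyAmenable.of_surjective {G H : Type*} [Group G] [Group H]
    (hG : IsStronglyAmenable G) (φ : G →* H) (hφ : Function.Surjective φ) :
    IsStronglyAmenable H := by
  intro X _ _ _ _ _ _ hp
  let _ : MulAction G X := MulAction.compHom X φ
  have : ContinuousConstSMul G X := ⟨fun g => continuous_const_smul (φ g)⟩
  obtain ⟨z, hz⟩ := hG X (by
    intro x y
    obtain ⟨z, hz⟩ := hp x y
    refine ⟨z, closure_mono ?_ hz⟩
    rintro _ ⟨h, rfl⟩
    obtain ⟨g, rfl⟩ := hφ h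
    exact ⟨g, rfl⟩)
  refine ⟨z, fun h => ?_⟩
  obtain ⟨g, rfl⟩ := hφ h
  exact hz g

/-- The left translation action of `G` on a set of configurations that is closed under
translations. -/
abbrev translationAction {G : Type*} [Group G] (S : Set (G → Bool))
    (hS : ∀ (g : G), ∀ x ∈ S, (fun h => x (g * h)) ∈ S) : MulAction G S where
  smul g x := ⟨fun h => x.1 (g⁻¹ * h), hS g⁻¹ x.1 x.2⟩
  one_smul x := Subtype.ext (funext fun h => congrArg x.1 (by simp))
  mul_smul g k x := Subtype.ext (funext fun h => congrArg x.1 (by simp [mul_assoc]))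

open Topology in
theorem IsICC.not_isStronglyAmenable {G : Type} [Group G] [Countable G] (hG : IsICC G) :
    ¬ IsStronglyAmenable G := by
  intro hSA
  obtain ⟨a, ha⟩ := @exists_ne G hG.1 1
  have hS₀ := isStronglyIrreducibleShift_isNet (Z := {1, a, a⁻¹}) (by simp) (by simp) (by simp)
  obtain ⟨e, he⟩ := exists_surjective_nat (Finset G)
  choose! f hfS hf hfe using fun (S : Set (G → Bool)) (hS : IsStronglyIrreducibleShift S)
    (n : ℕ) => hS.exists_subset_agreeing hG (e n).finite_toSet
  set S₀ := {x : G → Bool | IsNet {1, a, a⁻¹} Set.univ {g | x g = true}} with hS₀def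
  let S : ℕ → Set (G → Bool) := fun n => Nat.rec S₀ (fun n T => f T n) n
  have hS : ∀ n, IsStronglyIrreducibleShift (S n) := by
    intro n
    induction n with
    | zero => exact hS₀
    | succ n ih => exact hf _ ih n
  have hne : (⋂ n, S n).Nonempty :=
    IsCompact.nonempty_iInter_of_sequence_nonempty_isCompact_isClosed S
      (fun n => hfS _ (hS n) n)
      (fun n => (hS n).exists_irreducible.choose_spec.2.nonempty)
      (hS 0).isClosed.isCompact (fun n => (hS n).isClosed)
  have hcl : IsClosed (⋂ n, S n) := isClosed_iInter fun n => (hS n).isClosed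
  let _ : MulAction G (⋂ n, S n : Set (G → Bool)) := translationAction _ fun g x hx =>
    Set.mem_iInter.2 fun n => (hS n).translate_mem g x (Set.mem_iInter.1 hx n)
  have : CompactSpace (⋂ n, S n : Set (G → Bool)) := isCompact_iff_compactSpace.1 hcl.isCompact
  have : Nonempty (⋂ n, S n : Set (G → Bool)) := hne.to_subtype
  have : ContinuousConstSMul G (⋂ n, S n : Set (G → Bool)) := ⟨fun g => by
    refine continuous_induced_rng.2 (continuous_pi fun h => ?_)
    exact (continuous_apply (g⁻¹ * h)).comp continuous_subtype_val⟩
  have hsmul : ∀ (g : G) (x : (⋂ n, S n : Set (G → Bool))) (h : G),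
      (g • x).1 h = x.1 (g⁻¹ * h) := fun _ _ _ => rfl
  obtain ⟨z, hz⟩ := hSA (⋂ n, S n : Set (G → Bool)) (by
    intro x y
    have hagree : ∀ F : Finset G, ∃ g, ∀ k ∈ F, x.1 (g * k) = y.1 (g * k) := by
      intro F
      obtain ⟨n, rfl⟩ := he F
      exact hfe _ (hS n) n x.1 (Set.mem_iInter.1 x.2 (n + 1)) y.1 (Set.mem_iInter.1 y.2 (n + 1))
    choose g hg using hagree
    let u : Ultrafilter (Finset G) := Ultrafilter.of Filter.atTop
    have hu : (u : Filter (Finset G)) ≤ Filter.atTop := Ultrafilter.of_le _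
    obtain ⟨z, -, hz⟩ := isCompact_univ.ultrafilter_le_nhds
      (u.map fun F => (g F)⁻¹ • x) (by simp)
    have hx : Filter.Tendsto (fun F => (g F)⁻¹ • x) u (𝓝 z) := hz
    refine ⟨z, mem_closure_of_tendsto (hx.prodMk_nhds (?_ :
      Filter.Tendsto (fun F => (g F)⁻¹ • y) u (𝓝 z))) (.of_forall fun F => ⟨(g F)⁻¹, rfl⟩)⟩
    rw [tendsto_subtype_rng, tendsto_pi_nhds] at hx ⊢
    intro k
    refine (hx k).congr' ?_
    filter_upwards [hu (Filter.eventually_ge_atTop {k})] with F hF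
    simpa [hsmul] using hg F k (hF (Finset.mem_singleton_self k)))
  have hconst : ∀ h, z.1 h = z.1 1 := by
    intro h
    have := hsmul h⁻¹ z 1
    rw [hz h⁻¹] at this
    simpa using this.symm
  have hnet : IsNet {1, a, a⁻¹} Set.univ {g | z.1 g = true} := Set.mem_iInter.1 z.2 0
  obtain ⟨t, -, ht⟩ := hnet.exists_mul_mem 1 (Set.mem_univ _)
  have h1 : z.1 1 = true := (hconst _).symm.trans ht
  exact ha (hnet.eq_of_mem 1 h1 a ((hconst a).trans h1) (by simp)).symm

/-- A finitely generated group is strongly amenable if and only if it is virtually nilpotent,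
i.e. it has a nilpotent subgroup of finite index. -/
theorem fg_stronglyAmenable_iff_virtually_nilpotent (G : Type) [Group G] (hFG : Group.FG G) :
    IsStronglyAmenable G ↔ ∃ H : Subgroup G, H.FiniteIndex ∧ Group.IsNilpotent H := by
  constructor
  · intro hSA
    by_contra hno
    obtain ⟨N, hN, hICC⟩ := exists_normal_isICC_quotient hFG fun h =>
      hno (exists_finiteIndex_isNilpotent_of_isVirtuallyConilpotent h)
    obtain ⟨T, _, φ, hφ⟩ := Group.fg_iff_exists_freeGroup_hom_surjective_finite.1 hFG
    have : Countable G := hφ.countable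
    have : Countable (G ⧸ N) := (QuotientGroup.mk'_surjective N).countable
    exact hICC.not_isStronglyAmenable
      (hSA.of_surjective (QuotientGroup.mk' N) (QuotientGroup.mk'_surjective N))
  · rintro ⟨H, _, _⟩
    exact isStronglyAmenable_of_virtually_nilpotent H
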